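/- Let ν, μ ∈ ℝ^{n+1} with η(ν,ν) = −1, η(μ,μ) = 1, η(μ,e) = 0 (e = e_{n+1}), set α := η(ν,μ), v := −η(ν,e), ν^Σ := ν − αμ, e^τ := e − (v/(1+α²))ν^Σ, and let κ ∈ ℝ. Define the bilinear form B(X,Y) := κ·( η(X,Y) + η(X,e)·η(Y,e) ) (the second fundamental form of a vertical cylinder over a plane curve of curvature κ, evaluated on vectors orthogonal to μ). Then: (i) B(ν^Σ, ν^Σ) = (v² − 1 − α²)·κ; and (ii) if v² > 1 + α², then T := √(1+α²)·(v²−1−α²)^{−1/2}·e^τ satisfies η(T,T) = 1 and B(T,T) = v²κ/(1+α²). -/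

import Mathlib

noncomputable section

/-- The Minkowski inner product `η` on `ℝ^{n+1}`:
`η(x,y) = ∑_{i=1}^n xᵢyᵢ - x_{n+1}y_{n+1}`. -/
def eta {n : ℕ} (x y : Fin (n + 1) → ℝ) : ℝ :=
  (∑ i : Fin n, x i.castSucc * y i.castSucc) - x (Fin.last n) * y (Fin.last n)

/-- The timelike coordinate vector `e := e_{n+1}`, with `η(e,e) = -1`. -/
def eVec (n : ℕ) : Fin (n + 1) → ℝ := Pi.single (Fin.last n) 1

theorem eta_comm {n : ℕ} (x y : Fin (n + 1) → ℝ) : eta x y = eta y x := by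
  simp only [eta, mul_comm]

theorem eta_sub_left {n : ℕ} (x y z : Fin (n + 1) → ℝ) :
    eta (x - y) z = eta x z - eta y z := by
  simp only [eta, Pi.sub_apply, sub_mul, Finset.sum_sub_distrib]
  ring

theorem eta_smul_left {n : ℕ} (c : ℝ) (x y : Fin (n + 1) → ℝ) :
    eta (c • x) y = c * eta x y := by
  simp only [eta, Pi.smul_apply, smul_eq_mul, mul_assoc, mul_sub, Finset.mul_sum]

theorem eta_sub_right {n : ℕ} (x y z : Fin (n + 1) → ℝ) :
    eta x (y - z) = eta x y - eta x z := by
  rw [eta_comm, eta_sub_left, eta_comm y, eta_comm z]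

theorem eta_smul_right {n : ℕ} (c : ℝ) (x y : Fin (n + 1) → ℝ) :
    eta x (c • y) = c * eta x y := by
  rw [eta_comm, eta_smul_left, eta_comm]

theorem eta_eVec_self (n : ℕ) : eta (eVec n) (eVec n) = -1 := by
  simp [eta, eVec]

/-- **Equations `ASigma` and `ASigmaT`** (second fundamental form of the cylinder
evaluated on `ν^Σ` and on the unit tangent `T`): with
`B(X,Y) = κ(η(X,Y) + η(X,e)η(Y,e))` the second fundamental form of a vertical
cylinder over a plane curve of curvature `κ`, one has
(i) `B(ν^Σ,ν^Σ) = (v²-1-α²)κ`, and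
(ii) if `v² > 1+α²` then `T = √(1+α²)(v²-1-α²)^{-1/2} e^τ` satisfies `η(T,T) = 1`
and `B(T,T) = v²κ/(1+α²)`. -/
theorem cylinder_second_fundamental_form
    {n : ℕ} (ν μ : Fin (n + 1) → ℝ)
    (hν : eta ν ν = -1) (hμ : eta μ μ = 1) (hμe : eta μ (eVec n) = 0)
    (α v : ℝ) (hα : α = eta ν μ) (hv : v = -eta ν (eVec n))
    (νSig eτ : Fin (n + 1) → ℝ)
    (hνSig : νSig = ν - α • μ)
    (heτ : eτ = eVec n - (v / (1 + α ^ 2)) • νSig)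
    (κ : ℝ)
    (B : (Fin (n + 1) → ℝ) → (Fin (n + 1) → ℝ) → ℝ)
    (hB : ∀ X Y, B X Y = κ * (eta X Y + eta X (eVec n) * eta Y (eVec n))) :
    B νSig νSig = (v ^ 2 - 1 - α ^ 2) * κ ∧
    (v ^ 2 > 1 + α ^ 2 →
      ∀ T : Fin (n + 1) → ℝ,
        T = (Real.sqrt (1 + α ^ 2) / Real.sqrt (v ^ 2 - 1 - α ^ 2)) • eτ →
        eta T T = 1 ∧ B T T = v ^ 2 * κ / (1 + α ^ 2)) := by
  have hνe : eta ν (eVec n) = -v := by rw [hv, neg_neg]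
  have hSS : eta νSig νSig = -(1 + α ^ 2) := by
    rw [hνSig]
    simp only [eta_sub_left, eta_sub_right, eta_smul_left, eta_smul_right, hν, hμ,
      eta_comm μ ν, ← hα]
    ring
  have hSe : eta νSig (eVec n) = -v := by
    rw [hνSig, eta_sub_left, eta_smul_left, hμe, hνe]
    ring
  refine ⟨by rw [hB, hSS, hSe]; ring, ?_⟩
  rintro hgt T rfl
  have hw : 0 < 1 + α ^ 2 := by positivity
  have hd : 0 < v ^ 2 - 1 - α ^ 2 := by linarith
  have hττ : eta eτ eτ = (v ^ 2 - 1 - α ^ 2) / (1 + α ^ 2) := by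
    rw [heτ]
    simp only [eta_sub_left, eta_sub_right, eta_smul_left, eta_smul_right, eta_eVec_self,
      eta_comm (eVec n) νSig, hSS, hSe]
    field_simp
    ring
  have hτe : eta eτ (eVec n) = (v ^ 2 - 1 - α ^ 2) / (1 + α ^ 2) := by
    rw [heτ, eta_sub_left, eta_smul_left, eta_eVec_self, hSe]
    field_simp
    ring
  set c := Real.sqrt (1 + α ^ 2) / Real.sqrt (v ^ 2 - 1 - α ^ 2) with hc
  have hc2 : c * c = (1 + α ^ 2) / (v ^ 2 - 1 - α ^ 2) := by
    rw [hc, div_mul_div_comm, Real.mul_self_sqrt hw.le, Real.mul_self_sqrt hd.le]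
  have hTT : eta (c • eτ) (c • eτ) = 1 := by
    rw [eta_smul_left, eta_smul_right, ← mul_assoc, hc2, hττ]
    field_simp
  refine ⟨hTT, ?_⟩
  rw [hB, hTT, eta_smul_left, mul_mul_mul_comm, hc2, hτe]
  field_simp
  ring
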